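/- Under Assumption 1 (Φ_i^a(P_i(s)) = Φ_i^a(s) for all s ∈ L(G), i = 1,2) and nonemptiness of the observation maps (Φ_i^a(s) ≠ ∅ for s ∈ L(G) ∪ L(G_i)), every string in the conjunction large language projects into the local large languages: for all s ∈ L_a((S1^a ∧ S2^a)/G) and i = 1,2, P_i(s) ∈ L_a(S_i^a/G_i). -/

import Mathlib

attribute [local instance] Classical.propDecidable

noncomputable section

namespace DESCA

variable {E Q R : Type*}

/-- Natural projection onto a sub-alphabet `A`: erase all events not in `A`. -/
def proj (A : Set E) : List E → List E
  | [] => []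
  | a :: s => if a ∈ A then a :: proj A s else proj A s

/-- A language is prefix-closed if it contains every prefix of each of its members. -/
def PrefixClosed (L : Set (List E)) : Prop :=
  ∀ s t : List E, s <+: t → t ∈ L → s ∈ L

/-- Prefix closure of a language. -/
def prefixClosure (L : Set (List E)) : Set (List E) :=
  {s | ∃ t ∈ L, s <+: t}

/-- Strings over the sub-alphabet `A`. -/
def Strings (A : Set E) : Set (List E) := {s | ∀ a ∈ s, a ∈ A}

/-- Synchronous product of `L1 ⊆ A1*` and `L2 ⊆ A2*`:
`L1 ∥ L2 = P1⁻¹(L1) ∩ P2⁻¹(L2)`. -/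
def sync (A1 A2 : Set E) (L1 L2 : Set (List E)) : Set (List E) :=
  {s | proj A1 s ∈ L1 ∧ proj A2 s ∈ L2}

/-- Actuator-attack alteration of a control pattern `g`:
`Δ(g) = {(g \ g') ∪ g'' : g', g'' ⊆ Eca}`. -/
def Delta (Eca : Set E) (g : Set E) : Set (Set E) :=
  {ga | ∃ g' g'', g' ⊆ Eca ∧ g'' ⊆ Eca ∧ ga = (g \ g') ∪ g''}

/-- Large language `L_a(S^a/G)` of a single supervised system over alphabet `A`:
`ε` belongs to it, and for `s` in it and `σ ∈ A`, `s ++ [σ]` belongs to it iff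
`s ++ [σ] ∈ LG` and (`σ` uncontrollable, or enabled by some attacked control
`g ∈ Sa w` for some observation `w ∈ Phi s`). -/
inductive LargeLang (A : Set E) (LG : Set (List E)) (Euc : Set E)
    (Phi : List E → Set (List E)) (Sa : List E → Set (Set E)) : List E → Prop
  | nil : LargeLang A LG Euc Phi Sa []
  | step {s : List E} {σ : E} :
      LargeLang A LG Euc Phi Sa s → σ ∈ A → s ++ [σ] ∈ LG →
      (σ ∈ Euc ∨ ∃ w ∈ Phi s, ∃ g ∈ Sa w, σ ∈ g) →
      LargeLang A LG Euc Phi Sa (s ++ [σ])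

/-- Large language `L_a((S1^a ∧ S2^a)/G)` of the conjunctively supervised system:
`ε` belongs to it, and for `s` in it and `σ`, `s ++ [σ]` belongs to it iff
`s ++ [σ] ∈ LG` and (`σ` uncontrollable or
`∃ w1 ∈ Phi1 s, ∃ w2 ∈ Phi2 s, ∃ g1 ∈ Sa1 w1, ∃ g2 ∈ Sa2 w2,`
`σ ∈ (g1 ∪ (Σ \ A1)) ∩ (g2 ∪ (Σ \ A2))`). -/
inductive ConjLargeLang (A1 A2 : Set E) (LG : Set (List E)) (Euc : Set E)
    (Phi1 Phi2 : List E → Set (List E)) (Sa1 Sa2 : List E → Set (Set E)) :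
    List E → Prop
  | nil : ConjLargeLang A1 A2 LG Euc Phi1 Phi2 Sa1 Sa2 []
  | step {s : List E} {σ : E} :
      ConjLargeLang A1 A2 LG Euc Phi1 Phi2 Sa1 Sa2 s → s ++ [σ] ∈ LG →
      (σ ∈ Euc ∨ ∃ w1 ∈ Phi1 s, ∃ w2 ∈ Phi2 s, ∃ g1 ∈ Sa1 w1, ∃ g2 ∈ Sa2 w2,
        σ ∈ (g1 ∪ A1ᶜ) ∩ (g2 ∪ A2ᶜ)) →
      ConjLargeLang A1 A2 LG Euc Phi1 Phi2 Sa1 Sa2 (s ++ [σ])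

/-- Run of a deterministic automaton with partial transition function. -/
def dfaRun (δ : Q → E → Option Q) : Q → List E → Option Q
  | q, [] => some q
  | q, σ :: s => (δ q σ).bind fun q' => dfaRun δ q' s

/-- Language generated by a DFA with partial transition function:
strings whose run from `q0` is defined. -/
def dfaLang (δ : Q → E → Option Q) (q0 : Q) : Set (List E) :=
  {s | (dfaRun δ q0 s).isSome}

/-- Restriction of the transition function to a sub-automaton with state set `QH`. -/
def restrictDelta (δ : Q → E → Option Q) (QH : Set Q) (q : Q) (σ : E) : Option Q :=
  match δ q σ with
  | none => none
  | some q' => if q ∈ QH ∧ q' ∈ QH then some q' else none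

/-- Concrete sensor-attack map `Θ^a` along the run from state `q`:
`Θ^a(σ1⋯σn) = L1 L2 ⋯ Ln` where `Lk = {σk}` for a non-attacked transition and
`Lk = A_tr` (the attack language of the transition) for an attacked transition
(those labeled by events in `Eoa`). -/
def Theta (δ : Q → E → Option Q) (Eoa : Set E) (Att : Q → E → Set (List E)) :
    Q → List E → Set (List E)
  | _, [] => {([] : List E)}
  | q, σ :: s =>
    match δ q σ with
    | none => ∅
    | some q' =>
      {w | ∃ u v, u ∈ (if σ ∈ Eoa then Att q σ else {[σ]}) ∧
            v ∈ Theta δ Eoa Att q' s ∧ w = u ++ v}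

/-- Observation map `Φ^a(s) = P(Θ^a(s))` of the concrete sensor-attack model,
projecting onto the observable events `Eo`. -/
def PhiOf (δ : Q → E → Option Q) (q0 : Q) (Eo Eoa : Set E)
    (Att : Q → E → Set (List E)) (s : List E) : Set (List E) :=
  proj Eo '' Theta δ Eoa Att q0 s

/-- CA-controllability of `K` w.r.t. plant language `LG` and event set `A`
(`A` playing the role of `Σ_uc ∪ Σ_c^a`, possibly intersected with a local alphabet). -/
def CACont (K LG : Set (List E)) (A : Set E) : Prop :=
  ∀ s σ, s ∈ K → σ ∈ A → s ++ [σ] ∈ LG → s ++ [σ] ∈ K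

/-- CA-observability of `K` w.r.t. plant language `LG` and observation map `Phi`. -/
def CAObs (K LG : Set (List E)) (Phi : List E → Set (List E)) : Prop :=
  ∀ s σ, s ++ [σ] ∈ K →
    ∃ w ∈ Phi s, ∀ s' ∈ LG, w ∈ Phi s' → s' ∈ K →
      s' ++ [σ] ∈ LG → s' ++ [σ] ∈ K

/-- State estimate after observing `w`:
`E_H^a(w) = {q ∈ QH : ∃ s ∈ L(H), w ∈ Φ^a(s) ∧ δ_H(q0, s) = q}`. -/
def estimate (δH : Q → E → Option Q) (q0 : Q) (QH : Set Q)
    (Phi : List E → Set (List E)) (w : List E) : Set Q :=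
  {q | q ∈ QH ∧ ∃ s, dfaRun δH q0 s = some q ∧ w ∈ Phi s}

/-- Disablement set: events leading from some estimated state to an illegal state. -/
def rho (δ : Q → E → Option Q) (QH : Set Q) (x : Set Q) : Set E :=
  {σ | ∃ q ∈ x, ∃ q', δ q σ = some q' ∧ q' ∉ QH}

/-- State-estimate-based CA-supervisor:
`S_CA(w) = (Ei \ ρ(E_H^a(w))) ∪ (Euc ∩ Ei)` if `w ∈ Φ^a(L(H))`, else `Euc ∩ Ei`. -/
def CASup (δ δH : Q → E → Option Q) (q0 : Q) (QH : Set Q)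
    (Phi : List E → Set (List E)) (Ei Euc : Set E) (w : List E) : Set E :=
  if ∃ s ∈ dfaLang δH q0, w ∈ Phi s then
    (Ei \ rho δ QH (estimate δH q0 QH Phi w)) ∪ (Euc ∩ Ei)
  else Euc ∩ Ei

/-- A (nondeterministic) automaton with ε-moves: transitions are labeled by
`some σ` (an event) or `none` (ε). -/
structure ENFA (E : Type*) (Q : Type*) where
  start : Q
  step : Q → Option E → Q → Prop
  accept : Set Q

/-- `N.Reaches q s q'`: there is a run of the ε-NFA `N` from `q` to `q'`
reading the string `s`, interleaving arbitrarily many ε-moves. -/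
inductive ENFA.Reaches (N : ENFA E Q) : Q → List E → Q → Prop
  | refl (q : Q) : ENFA.Reaches N q [] q
  | eps {q q' q'' : Q} {s : List E} :
      N.step q none q' → ENFA.Reaches N q' s q'' → ENFA.Reaches N q s q''
  | symb {q q' q'' : Q} {σ : E} {s : List E} :
      N.step q (some σ) q' → ENFA.Reaches N q' s q'' →
      ENFA.Reaches N q (σ :: s) q''

/-- Marked language of an ε-NFA. -/
def ENFA.markedLang (N : ENFA E Q) : Set (List E) :=
  {s | ∃ q ∈ N.accept, N.Reaches N.start s q}

/-- Generated language of an ε-NFA: strings having at least one run from the start. -/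
def ENFA.genLang (N : ENFA E Q) : Set (List E) :=
  {s | ∃ q, N.Reaches N.start s q}

/-- Attack language `A_tr = L_m(F_tr)` marked by the attack automaton attached to
the transition leaving `q` on event `σ`. -/
def Atr (Finit : Q → E → R) (Fd : Q → E → R → E → Option R)
    (Fm : Q → E → Set R) (q : Q) (σ : E) : Set (List E) :=
  {t | ∃ r, dfaRun (Fd q σ) (Finit q σ) t = some r ∧ r ∈ Fm q σ}

/-- Transition relation of the extended automaton `G^a`: non-attacked transitions
are kept; each attacked transition `(q, σ, q')` (i.e. `σ ∈ Eoa` and `δ q σ` defined)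
is replaced by an ε-transition from `q` into the attack automaton `F_tr`, the
transitions of `F_tr`, and ε-transitions from marked states of `F_tr` to `q'`. -/
inductive GaStep (δ : Q → E → Option Q) (Eoa : Set E)
    (Finit : Q → E → R) (Fd : Q → E → R → E → Option R) (Fm : Q → E → Set R) :
    Q ⊕ Q × E × R → Option E → Q ⊕ Q × E × R → Prop
  | keep {q : Q} {σ : E} {q' : Q} :
      δ q σ = some q' → σ ∉ Eoa →
      GaStep δ Eoa Finit Fd Fm (Sum.inl q) (some σ) (Sum.inl q')
  | enter {q : Q} {σ : E} :
      σ ∈ Eoa → (δ q σ).isSome →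
      GaStep δ Eoa Finit Fd Fm (Sum.inl q) none (Sum.inr (q, σ, Finit q σ))
  | inner {q : Q} {σ : E} {r : R} {τ : E} {r' : R} :
      σ ∈ Eoa → (δ q σ).isSome → Fd q σ r τ = some r' →
      GaStep δ Eoa Finit Fd Fm (Sum.inr (q, σ, r)) (some τ) (Sum.inr (q, σ, r'))
  | exit {q : Q} {σ : E} {q' : Q} {r : R} :
      δ q σ = some q' → σ ∈ Eoa → r ∈ Fm q σ →
      GaStep δ Eoa Finit Fd Fm (Sum.inr (q, σ, r)) none (Sum.inl q')

/-- The extended ε-NFA `G^a`, whose marked states are the plant states. -/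
def Ga (δ : Q → E → Option Q) (q0 : Q) (Eoa : Set E)
    (Finit : Q → E → R) (Fd : Q → E → R → E → Option R) (Fm : Q → E → Set R) :
    ENFA E (Q ⊕ Q × E × R) where
  start := Sum.inl q0
  step := GaStep δ Eoa Finit Fd Fm
  accept := Set.range Sum.inl

/-- Relabel every transition labeled by an event not in `Eo` as an ε-transition,
keeping all other transitions and the marked states. -/
def relabel (Eo : Set E) (N : ENFA E Q) : ENFA E Q where
  start := N.start
  step := fun q a q' =>
    (∃ σ ∈ Eo, a = some σ ∧ N.step q (some σ) q') ∨
    (a = none ∧ (N.step q none q' ∨ ∃ σ, σ ∉ Eo ∧ N.step q (some σ) q'))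
  accept := N.accept

theorem proj_append (A : Set E) (s t : List E) :
    proj A (s ++ t) = proj A s ++ proj A t := by
  induction s with
  | nil => rfl
  | cons a s ih =>
    by_cases ha : a ∈ A <;> simp [proj, ha, ih]

theorem PrefixClosed.proj_mem_of_append {L : Set (List E)} (hL : PrefixClosed L)
    {A : Set E} {s t : List E} (h : proj A (s ++ t) ∈ L) : proj A s ∈ L :=
  hL _ _ ⟨proj A t, (proj_append A s t).symm⟩ h

theorem PrefixClosed.sync {A1 A2 : Set E} {L1 L2 : Set (List E)}
    (h1 : PrefixClosed L1) (h2 : PrefixClosed L2) : PrefixClosed (sync A1 A2 L1 L2) := by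
  rintro s _ ⟨t, rfl⟩ ⟨ht1, ht2⟩
  exact ⟨h1.proj_mem_of_append ht1, h2.proj_mem_of_append ht2⟩

theorem LargeLang.proj_append_singleton {A : Set E} {LG : Set (List E)} {Euc : Set E}
    {Phi : List E → Set (List E)} {Sa : List E → Set (Set E)} {s : List E} {σ : E}
    (hs : LargeLang A LG Euc Phi Sa (proj A s)) (hmem : proj A (s ++ [σ]) ∈ LG)
    (hen : σ ∈ Euc ∨ ∃ w ∈ Phi (proj A s), ∃ g ∈ Sa w, σ ∈ g ∪ Aᶜ) :
    LargeLang A LG Euc Phi Sa (proj A (s ++ [σ])) := by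
  rw [proj_append] at hmem ⊢
  by_cases hσ : σ ∈ A
  · have hproj : proj A [σ] = [σ] := by simp [proj, hσ]
    rw [hproj] at hmem ⊢
    refine hs.step hσ hmem (hen.imp_right ?_)
    rintro ⟨w, hw, g, hg, hσg⟩
    exact ⟨w, hw, g, hg, hσg.resolve_right (not_not_intro hσ)⟩
  · simpa [proj, hσ] using hs

/-- under Assumption 1 and nonemptiness of the observation maps, every
string of the conjunction large language projects into the local large languages. -/
theorem conj_mem_proj_local {E : Type*} [Fintype E]
    (E1 E2 Eo Ec Eca : Set E)
    (hcover : E1 ∪ E2 = Set.univ) (hca : Eca ⊆ Ec)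
    (LG1 LG2 : Set (List E))
    (hLG1pc : PrefixClosed LG1) (hLG2pc : PrefixClosed LG2)
    (hLG1str : LG1 ⊆ Strings E1) (hLG2str : LG2 ⊆ Strings E2)
    (Phi1 Phi2 : List E → Set (List E))
    (hA1 : ∀ s ∈ sync E1 E2 LG1 LG2, Phi1 (proj E1 s) = Phi1 s)
    (hA2 : ∀ s ∈ sync E1 E2 LG1 LG2, Phi2 (proj E2 s) = Phi2 s)
    (hne1 : ∀ s ∈ sync E1 E2 LG1 LG2 ∪ LG1, (Phi1 s).Nonempty)
    (hne2 : ∀ s ∈ sync E1 E2 LG1 LG2 ∪ LG2, (Phi2 s).Nonempty)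
    (S1 S2 : List E → Set E)
    (hS1 : ∀ w, S1 w ⊆ E1) (hS2 : ∀ w, S2 w ⊆ E2) :
    ∀ s, ConjLargeLang E1 E2 (sync E1 E2 LG1 LG2) Ecᶜ Phi1 Phi2
        (fun w => Delta (Eca ∩ E1) (S1 w)) (fun w => Delta (Eca ∩ E2) (S2 w)) s →
      LargeLang E1 LG1 Ecᶜ Phi1 (fun w => Delta (Eca ∩ E1) (S1 w)) (proj E1 s) ∧
      LargeLang E2 LG2 Ecᶜ Phi2 (fun w => Delta (Eca ∩ E2) (S2 w)) (proj E2 s) := by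
  intro s hs
  induction hs with
  | nil => exact ⟨.nil, .nil⟩
  | @step s σ _ hmem hen ih =>
    have hsync := hLG1pc.sync hLG2pc s _ (List.prefix_append s [σ]) hmem
    refine ⟨ih.1.proj_append_singleton hmem.1 (hen.imp_right ?_),
      ih.2.proj_append_singleton hmem.2 (hen.imp_right ?_)⟩
    · rintro ⟨w, hw, _, _, g, hg, _, _, hσ⟩
      exact ⟨w, (hA1 s hsync).symm ▸ hw, g, hg, hσ.1⟩
    · rintro ⟨_, _, w, hw, _, _, g, hg, hσ⟩
      exact ⟨w, (hA2 s hsync).symm ▸ hw, g, hg, hσ.2⟩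

end DESCA

end
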